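/- arXiv:1906.03621 — 9 statements merged into one kernel-verified Lean document; each statement's English description precedes it below -/
import Mathlib

section
/- Let H be a real inner product space, G : H → H a continuous linear operator with ⟨Gμ, μ⟩ ≤ 0 for all μ ∈ H, and L : H → H a continuous linear operator that is symmetric (⟨Lx, y⟩ = ⟨x, Ly⟩ for all x, y). Let φ, q : ℝ → H be differentiable curves, μ : ℝ → H, and B(t) : H → H a family of continuous linear operators, each self-adjoint (⟨B(t)x, y⟩ = ⟨x, B(t)y⟩ for all x, y), such that for all t: φ'(t) = G μ(t), μ(t) = L φ(t) + B(t) q(t), and q'(t) = (1/2) B(t) φ'(t). Then the modified energy t ↦ (1/2)⟨L φ(t), φ(t)⟩ + ‖q(t)‖² has derivative ⟨G μ(t), μ(t)⟩ at every t, and this derivative is ≤ 0. -/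
open scoped RealInnerProductSpace

/-- Continuous-time modified energy dissipation law of the IEQ reformulation. -/
theorem ieq_energy_dissipation {H : Type*} [NormedAddCommGroup H] [InnerProductSpace ℝ H]
    (G L : H →L[ℝ] H)
    (hG : ∀ μ : H, ⟪G μ, μ⟫ ≤ 0)
    (hL : ∀ x y : H, ⟪L x, y⟫ = ⟪x, L y⟫)
    (φ q μ : ℝ → H) (φ' q' : ℝ → H)
    (B : ℝ → H →L[ℝ] H)
    (hB : ∀ t, ∀ x y : H, ⟪B t x, y⟫ = ⟪x, B t y⟫)
    (hφ : ∀ t, HasDerivAt φ (φ' t) t)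
    (hq : ∀ t, HasDerivAt q (q' t) t)
    (heq1 : ∀ t, φ' t = G (μ t))
    (heq2 : ∀ t, μ t = L (φ t) + B t (q t))
    (heq3 : ∀ t, q' t = (1 / 2 : ℝ) • B t (φ' t)) :
    ∀ t : ℝ,
      HasDerivAt (fun s => (1 / 2 : ℝ) * ⟪L (φ s), φ s⟫ + ‖q s‖ ^ 2)
        ⟪G (μ t), μ t⟫ t ∧ ⟪G (μ t), μ t⟫ ≤ 0 := by
  intro t
  refine ⟨?_, hG _⟩
  have h1 : HasDerivAt (fun s => L (φ s)) (L (φ' t)) t :=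
    L.hasFDerivAt.comp_hasDerivAt t (hφ t)
  have h2 := ((h1.inner ℝ (hφ t)).const_mul (1 / 2 : ℝ)).add (hq t).norm_sq
  refine h2.congr_deriv ?_
  have e1 : ⟪L (φ' t), φ t⟫ = ⟪φ' t, L (φ t)⟫ := hL _ _
  have e2 : ⟪L (φ t), φ' t⟫ = ⟪φ' t, L (φ t)⟫ := real_inner_comm _ _
  have e3 : ⟪q t, q' t⟫ = (1 / 2 : ℝ) * ⟪φ' t, B t (q t)⟫ := by
    rw [heq3, real_inner_smul_right, real_inner_comm, hB]
  have e4 : ⟪G (μ t), μ t⟫ = ⟪φ' t, L (φ t)⟫ + ⟪φ' t, B t (q t)⟫ := by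
    rw [← heq1, heq2, inner_add_right]
  rw [e1, e2, e3, e4]
  ring
end

section
/- Let H be a real inner product space, G : H → H a continuous linear operator with ⟨Gμ, μ⟩ ≤ 0 for all μ ∈ H, and L : H → H a continuous linear operator that is symmetric (⟨Lx, y⟩ = ⟨x, Ly⟩ for all x, y). Let φ, q, u : ℝ → H be differentiable curves, μ : ℝ → H, and B(t), C(t) : H → H families of continuous linear operators, each self-adjoint, such that for all t: φ'(t) = G μ(t), μ(t) = L φ(t) + B(t) q(t) − C(t) u(t), q'(t) = (1/2) B(t) φ'(t), and u'(t) = (1/2) C(t) φ'(t). Then the modified energy t ↦ (1/2)⟨L φ(t), φ(t)⟩ + ‖q(t)‖² − ‖u(t)‖² has derivative ⟨G μ(t), μ(t)⟩ at every t, and this derivative is ≤ 0. -/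
open scoped RealInnerProductSpace

/-- Continuous-time energy dissipation law of the double IEQ reformulation. -/
theorem double_ieq_energy_dissipation {H : Type*} [NormedAddCommGroup H] [InnerProductSpace ℝ H]
    (G L : H →L[ℝ] H)
    (hG : ∀ μ : H, ⟪G μ, μ⟫ ≤ 0)
    (hL : ∀ x y : H, ⟪L x, y⟫ = ⟪x, L y⟫)
    (φ q u μ : ℝ → H) (φ' q' u' : ℝ → H)
    (B C : ℝ → H →L[ℝ] H)
    (hB : ∀ t, ∀ x y : H, ⟪B t x, y⟫ = ⟪x, B t y⟫)
    (hC : ∀ t, ∀ x y : H, ⟪C t x, y⟫ = ⟪x, C t y⟫)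
    (hφ : ∀ t, HasDerivAt φ (φ' t) t)
    (hq : ∀ t, HasDerivAt q (q' t) t)
    (hu : ∀ t, HasDerivAt u (u' t) t)
    (heq1 : ∀ t, φ' t = G (μ t))
    (heq2 : ∀ t, μ t = L (φ t) + B t (q t) - C t (u t))
    (heq3 : ∀ t, q' t = (1 / 2 : ℝ) • B t (φ' t))
    (heq4 : ∀ t, u' t = (1 / 2 : ℝ) • C t (φ' t)) :
    ∀ t : ℝ,
      HasDerivAt (fun s => (1 / 2 : ℝ) * ⟪L (φ s), φ s⟫ + ‖q s‖ ^ 2 - ‖u s‖ ^ 2)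
        ⟪G (μ t), μ t⟫ t ∧ ⟪G (μ t), μ t⟫ ≤ 0 := by
  intro t
  refine ⟨?_, hG _⟩
  have h1 : HasDerivAt (fun s => ⟪L (φ s), φ s⟫) (⟪L (φ t), φ' t⟫ + ⟪L (φ' t), φ t⟫) t :=
    HasDerivAt.inner ℝ (L.hasFDerivAt.comp_hasDerivAt t (hφ t)) (hφ t)
  have h2 := (hq t).norm_sq
  have h3 := (hu t).norm_sq
  have h := ((h1.const_mul (1 / 2 : ℝ)).add h2).sub h3
  refine h.congr_deriv ?_
  have e1 : ⟪L (φ' t), φ t⟫ = ⟪φ' t, L (φ t)⟫ := hL _ _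
  have e2 : ⟪L (φ t), φ' t⟫ = ⟪φ' t, L (φ t)⟫ := real_inner_comm _ _
  have e3 : ⟪q t, B t (φ' t)⟫ = ⟪φ' t, B t (q t)⟫ := by
    rw [← hB, real_inner_comm]
  have e4 : ⟪u t, C t (φ' t)⟫ = ⟪φ' t, C t (u t)⟫ := by
    rw [← hC, real_inner_comm]
  have e5 : ⟪G (μ t), μ t⟫ = ⟪φ' t, L (φ t)⟫ + ⟪φ' t, B t (q t)⟫ - ⟪φ' t, C t (u t)⟫ := by
    rw [← heq1, heq2 t, inner_sub_right, inner_add_right]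
  rw [e5, heq3, heq4, inner_smul_right, inner_smul_right, e1, e2, e3, e4]
  ring
end

section
/- Let H be a real inner product space, G : H → H a continuous linear operator with ⟨Gμ, μ⟩ ≤ 0 for all μ ∈ H, and L : H → H a continuous linear operator that is symmetric (⟨Lx, y⟩ = ⟨x, Ly⟩ for all x, y). Let φ : ℝ → H and r : ℝ → ℝ be differentiable, μ, b : ℝ → H, such that for all t: φ'(t) = G μ(t), μ(t) = L φ(t) + r(t)·b(t), and r'(t) = (1/2)⟨b(t), φ'(t)⟩. Then the modified energy t ↦ (1/2)⟨L φ(t), φ(t)⟩ + r(t)² has derivative ⟨G μ(t), μ(t)⟩ at every t, and this derivative is ≤ 0. -/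
open scoped RealInnerProductSpace

/-- Continuous-time modified energy dissipation law of the SAV reformulation. -/
theorem sav_energy_dissipation {H : Type*} [NormedAddCommGroup H] [InnerProductSpace ℝ H]
    (G L : H →L[ℝ] H)
    (hG : ∀ μ : H, ⟪G μ, μ⟫ ≤ 0)
    (hL : ∀ x y : H, ⟪L x, y⟫ = ⟪x, L y⟫)
    (φ μ b : ℝ → H) (φ' : ℝ → H) (r r' : ℝ → ℝ)
    (hφ : ∀ t, HasDerivAt φ (φ' t) t)
    (hr : ∀ t, HasDerivAt r (r' t) t)
    (heq1 : ∀ t, φ' t = G (μ t))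
    (heq2 : ∀ t, μ t = L (φ t) + r t • b t)
    (heq3 : ∀ t, r' t = (1 / 2 : ℝ) * ⟪b t, φ' t⟫) :
    ∀ t : ℝ,
      HasDerivAt (fun s => (1 / 2 : ℝ) * ⟪L (φ s), φ s⟫ + (r s) ^ 2)
        ⟪G (μ t), μ t⟫ t ∧ ⟪G (μ t), μ t⟫ ≤ 0 := by
  intro t
  refine ⟨?_, hG _⟩
  have h1 : HasDerivAt (fun s => L (φ s)) (L (φ' t)) t :=
    L.hasFDerivAt.comp_hasDerivAt t (hφ t)
  have h2 := ((h1.inner ℝ (hφ t)).const_mul (1 / 2 : ℝ)).add ((hr t).pow 2)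
  refine h2.congr_deriv ?_
  have e : ⟪G (μ t), μ t⟫ = ⟪φ' t, L (φ t)⟫ + r t * ⟪b t, φ' t⟫ := by
    rw [← heq1 t]
    conv_lhs => rw [heq2 t]
    rw [inner_add_right, real_inner_smul_right, real_inner_comm (b t)]
  rw [e, hL (φ' t) (φ t), heq3 t, real_inner_comm (φ' t) (L (φ t))]
  push_cast
  ring
end

section
/- Let H be a real inner product space, G : H → H a continuous linear operator with ⟨Gμ, μ⟩ ≤ 0 for all μ ∈ H, and L : H → H a continuous linear operator that is symmetric (⟨Lx, y⟩ = ⟨x, Ly⟩ for all x, y). Let φ : ℝ → H and r, m : ℝ → ℝ be differentiable, μ, b, c : ℝ → H, such that for all t: φ'(t) = G μ(t), μ(t) = L φ(t) + r(t)·b(t) − m(t)·c(t), r'(t) = (1/2)⟨b(t), φ'(t)⟩, and m'(t) = (1/2)⟨c(t), φ'(t)⟩. Then the modified energy t ↦ (1/2)⟨L φ(t), φ(t)⟩ + r(t)² − m(t)² has derivative ⟨G μ(t), μ(t)⟩ at every t, and this derivative is ≤ 0. -/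
open scoped RealInnerProductSpace

/-- Continuous-time energy dissipation law of the double SAV (MSAV) reformulation. -/
theorem double_sav_energy_dissipation {H : Type*} [NormedAddCommGroup H] [InnerProductSpace ℝ H]
    (G L : H →L[ℝ] H)
    (hG : ∀ μ : H, ⟪G μ, μ⟫ ≤ 0)
    (hL : ∀ x y : H, ⟪L x, y⟫ = ⟪x, L y⟫)
    (φ μ b c : ℝ → H) (φ' : ℝ → H) (r r' m m' : ℝ → ℝ)
    (hφ : ∀ t, HasDerivAt φ (φ' t) t)
    (hr : ∀ t, HasDerivAt r (r' t) t)
    (hm : ∀ t, HasDerivAt m (m' t) t)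
    (heq1 : ∀ t, φ' t = G (μ t))
    (heq2 : ∀ t, μ t = L (φ t) + r t • b t - m t • c t)
    (heq3 : ∀ t, r' t = (1 / 2 : ℝ) * ⟪b t, φ' t⟫)
    (heq4 : ∀ t, m' t = (1 / 2 : ℝ) * ⟪c t, φ' t⟫) :
    ∀ t : ℝ,
      HasDerivAt (fun s => (1 / 2 : ℝ) * ⟪L (φ s), φ s⟫ + (r s) ^ 2 - (m s) ^ 2)
        ⟪G (μ t), μ t⟫ t ∧ ⟪G (μ t), μ t⟫ ≤ 0 := by
  intro t
  refine ⟨?_, hG _⟩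
  have hLφ : HasDerivAt (fun s => L (φ s)) (L (φ' t)) t :=
    L.hasFDerivAt.comp_hasDerivAt t (hφ t)
  have h := (((hLφ.inner ℝ (hφ t)).const_mul (1 / 2 : ℝ)).add ((hr t).pow 2)).sub ((hm t).pow 2)
  refine h.congr_deriv ?_
  have e : ⟪G (μ t), μ t⟫ = ⟪L (φ t), φ' t⟫ + r t * ⟪b t, φ' t⟫ - m t * ⟪c t, φ' t⟫ := by
    rw [← heq1 t, real_inner_comm, heq2 t, inner_sub_left, inner_add_left,
      real_inner_smul_left, real_inner_smul_left]
  have e2 : ⟪L (φ' t), φ t⟫ = ⟪L (φ t), φ' t⟫ := by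
    rw [hL, real_inner_comm]
  rw [e, e2, heq3 t, heq4 t]
  push_cast
  ring
end

section
/- Let H be a real inner product space, G : H → H a continuous linear operator with ⟨Gμ, μ⟩ ≤ 0 for all μ ∈ H, L : H → H a continuous linear operator that is symmetric (⟨Lx, y⟩ = ⟨x, Ly⟩), and Δt > 0. Let Bₙ, Cₙ : H → H be self-adjoint continuous linear operators, and let φⁿ, φⁿ⁺¹, qⁿ, qⁿ⁺¹, uⁿ, uⁿ⁺¹, μ ∈ H satisfy: φⁿ⁺¹ − φⁿ = Δt·Gμ; μ = L((φⁿ⁺¹ + φⁿ)/2) + Bₙ((qⁿ⁺¹ + qⁿ)/2) − Cₙ((uⁿ⁺¹ + uⁿ)/2); qⁿ⁺¹ − qⁿ = (1/2)Bₙ(φⁿ⁺¹ − φⁿ); uⁿ⁺¹ − uⁿ = (1/2)Cₙ(φⁿ⁺¹ − φⁿ). Define Eᵐ = (1/2)⟨Lφᵐ, φᵐ⟩ + ‖qᵐ‖² − ‖uᵐ‖² for m = n, n+1. Then Eⁿ⁺¹ − Eⁿ ≤ Δt·⟨Gμ, μ⟩ ≤ 0. -/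
open scoped RealInnerProductSpace

/-- Unconditional energy stability of the double IEQ Crank–Nicolson scheme. -/
theorem double_ieq_cn_energy_stable {H : Type*} [NormedAddCommGroup H] [InnerProductSpace ℝ H]
    (G L : H →L[ℝ] H)
    (hG : ∀ μ : H, ⟪G μ, μ⟫ ≤ 0)
    (hL : ∀ x y : H, ⟪L x, y⟫ = ⟪x, L y⟫)
    (Δt : ℝ) (hΔt : 0 < Δt)
    (B C : H →L[ℝ] H)
    (hB : ∀ x y : H, ⟪B x, y⟫ = ⟪x, B y⟫)
    (hC : ∀ x y : H, ⟪C x, y⟫ = ⟪x, C y⟫)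
    (φn φn1 qn qn1 un un1 μ : H)
    (heq1 : φn1 - φn = Δt • G μ)
    (heq2 : μ = L ((1 / 2 : ℝ) • (φn1 + φn)) + B ((1 / 2 : ℝ) • (qn1 + qn))
      - C ((1 / 2 : ℝ) • (un1 + un)))
    (heq3 : qn1 - qn = (1 / 2 : ℝ) • B (φn1 - φn))
    (heq4 : un1 - un = (1 / 2 : ℝ) • C (φn1 - φn)) :
    ((1 / 2 : ℝ) * ⟪L φn1, φn1⟫ + ‖qn1‖ ^ 2 - ‖un1‖ ^ 2)
      - ((1 / 2 : ℝ) * ⟪L φn, φn⟫ + ‖qn‖ ^ 2 - ‖un‖ ^ 2)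
      ≤ Δt * ⟪G μ, μ⟫ ∧ Δt * ⟪G μ, μ⟫ ≤ 0 := by
  have key : ∀ (A : H →L[ℝ] H), (∀ x y : H, ⟪A x, y⟫ = ⟪x, A y⟫) → ∀ a b : H,
      a - b = (1 / 2 : ℝ) • A (φn1 - φn) →
      ⟪φn1 - φn, A ((1 / 2 : ℝ) • (a + b))⟫ = ‖a‖ ^ 2 - ‖b‖ ^ 2 := by
    intro A hA a b h
    have h2 : A (φn1 - φn) = (2 : ℝ) • (a - b) := by
      rw [h, smul_smul]; norm_num
    rw [← hA, h2, real_inner_smul_left, real_inner_smul_right, inner_sub_left,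
      inner_add_right, inner_add_right, real_inner_self_eq_norm_sq,
      real_inner_self_eq_norm_sq, real_inner_comm a b]
    ring
  have hLL : ⟪φn1 - φn, L ((1 / 2 : ℝ) • (φn1 + φn))⟫
      = (1 / 2 : ℝ) * ⟪L φn1, φn1⟫ - (1 / 2 : ℝ) * ⟪L φn, φn⟫ := by
    rw [← hL, map_sub, real_inner_smul_right, inner_sub_left, inner_add_right,
      inner_add_right, hL φn φn1, real_inner_comm (L φn1) φn]
    ring
  have hmain : Δt * ⟪G μ, μ⟫ = ⟪φn1 - φn, μ⟫ := by
    rw [heq1, real_inner_smul_left]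
  refine ⟨le_of_eq ?_, mul_nonpos_of_nonneg_of_nonpos hΔt.le (hG μ)⟩
  have hq := key B hB qn1 qn heq3
  have hu := key C hC un1 un heq4
  have hμ : ⟪φn1 - φn, μ⟫ = ⟪φn1 - φn, L ((1 / 2 : ℝ) • (φn1 + φn))⟫
      + ⟪φn1 - φn, B ((1 / 2 : ℝ) • (qn1 + qn))⟫
      - ⟪φn1 - φn, C ((1 / 2 : ℝ) • (un1 + un))⟫ := by
    rw [← inner_add_right, ← inner_sub_right, ← heq2]
  rw [hmain, hμ, hLL, hq, hu]
  ring
end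

section
/- Let H be a real inner product space, G : H → H a continuous linear operator with ⟨Gμ, μ⟩ ≤ 0 for all μ ∈ H, L : H → H a continuous linear operator that is symmetric (⟨Lx, y⟩ = ⟨x, Ly⟩), Δt > 0 and S > 0. Let Bₙ : H → H be a self-adjoint continuous linear operator, and let φⁿ⁻¹, φⁿ, φⁿ⁺¹, qⁿ, qⁿ⁺¹, μ ∈ H satisfy: φⁿ⁺¹ − φⁿ = Δt·Gμ; μ = L((φⁿ⁺¹ + φⁿ)/2) + Bₙ((qⁿ⁺¹ + qⁿ)/2) − S·(3φⁿ − φⁿ⁻¹); qⁿ⁺¹ − qⁿ = (1/2)Bₙ(φⁿ⁺¹ − φⁿ). Define E(x, y, q) = (1/2)⟨Lx, x⟩ + ‖q‖² + (S/2)‖x − y‖² − S‖x‖². Then E(φⁿ⁺¹, φⁿ, qⁿ⁺¹) − E(φⁿ, φⁿ⁻¹, qⁿ) ≤ Δt·⟨Gμ, μ⟩ ≤ 0. -/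
open scoped RealInnerProductSpace

/-- Unconditional energy stability of the MIEQ Crank–Nicolson scheme with linear
`M'(φ) = 2Sφ` (case `n ≥ 1`). -/
theorem mieq_cn_energy_stable {H : Type*} [NormedAddCommGroup H] [InnerProductSpace ℝ H]
    (G L : H →L[ℝ] H)
    (hG : ∀ μ : H, ⟪G μ, μ⟫ ≤ 0)
    (hL : ∀ x y : H, ⟪L x, y⟫ = ⟪x, L y⟫)
    (Δt S : ℝ) (hΔt : 0 < Δt) (hS : 0 < S)
    (B : H →L[ℝ] H)
    (hB : ∀ x y : H, ⟪B x, y⟫ = ⟪x, B y⟫)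
    (φnm1 φn φn1 qn qn1 μ : H)
    (heq1 : φn1 - φn = Δt • G μ)
    (heq2 : μ = L ((1 / 2 : ℝ) • (φn1 + φn)) + B ((1 / 2 : ℝ) • (qn1 + qn))
      - S • ((3 : ℝ) • φn - φnm1))
    (heq3 : qn1 - qn = (1 / 2 : ℝ) • B (φn1 - φn))
    (E : H → H → H → ℝ)
    (hE : ∀ x y q : H, E x y q =
      (1 / 2 : ℝ) * ⟪L x, x⟫ + ‖q‖ ^ 2 + (S / 2) * ‖x - y‖ ^ 2 - S * ‖x‖ ^ 2) :
    E φn1 φn qn1 - E φn φnm1 qn ≤ Δt * ⟪G μ, μ⟫ ∧ Δt * ⟪G μ, μ⟫ ≤ 0 := by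
  have hneg : Δt * ⟪G μ, μ⟫ ≤ 0 := mul_nonpos_of_nonneg_of_nonpos hΔt.le (hG μ)
  refine ⟨?_, hneg⟩
  have h1 : Δt * ⟪G μ, μ⟫ = ⟪φn1 - φn, μ⟫ := by rw [heq1, real_inner_smul_left]
  have hLpart : ⟪φn1 - φn, L ((1 / 2 : ℝ) • (φn1 + φn))⟫
      = (1 / 2 : ℝ) * ⟪L φn1, φn1⟫ - (1 / 2 : ℝ) * ⟪L φn, φn⟫ := by
    have e : ⟪φn1, L φn⟫ = ⟪φn, L φn1⟫ := by rw [← hL, real_inner_comm]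
    rw [map_smul, map_add, real_inner_smul_right, inner_add_right, inner_sub_left,
      inner_sub_left, hL φn1, hL φn, e]
    ring
  have hBd : B (φn1 - φn) = (2 : ℝ) • (qn1 - qn) := by
    rw [heq3, smul_smul]; norm_num
  have hBpart : ⟪φn1 - φn, B ((1 / 2 : ℝ) • (qn1 + qn))⟫ = ‖qn1‖ ^ 2 - ‖qn‖ ^ 2 := by
    rw [← hB, hBd, real_inner_smul_left, real_inner_smul_right, inner_sub_left,
      inner_add_right, inner_add_right, real_inner_self_eq_norm_sq,
      real_inner_self_eq_norm_sq, real_inner_comm qn qn1]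
    ring
  have hsq : 0 ≤ S / 2 * ‖(φn1 - φn) - (φn - φnm1)‖ ^ 2 := by positivity
  have hSpart : (S / 2) * ‖φn1 - φn‖ ^ 2 - S * ‖φn1‖ ^ 2 - (S / 2) * ‖φn - φnm1‖ ^ 2
      + S * ‖φn‖ ^ 2 = - (S * ⟪φn1 - φn, (3 : ℝ) • φn - φnm1⟫)
        - S / 2 * ‖(φn1 - φn) - (φn - φnm1)‖ ^ 2 := by
    simp only [← real_inner_self_eq_norm_sq, inner_sub_left, inner_sub_right,
      real_inner_smul_right]
    rw [real_inner_comm φn φn1, real_inner_comm φnm1 φn1, real_inner_comm φnm1 φn]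
    ring
  have h2 : ⟪φn1 - φn, μ⟫ = ⟪φn1 - φn, L ((1 / 2 : ℝ) • (φn1 + φn))⟫
      + ⟪φn1 - φn, B ((1 / 2 : ℝ) • (qn1 + qn))⟫
      - S * ⟪φn1 - φn, (3 : ℝ) • φn - φnm1⟫ := by
    rw [← real_inner_smul_right, ← inner_add_right, ← inner_sub_right, ← heq2]
  rw [h1, h2, hLpart, hBpart, hE, hE]
  linarith
end

section
/- Let H be a real inner product space, G : H → H a continuous linear operator with ⟨Gμ, μ⟩ ≤ 0 for all μ ∈ H, L : H → H a continuous linear operator that is symmetric (⟨Lx, y⟩ = ⟨x, Ly⟩) and non-negative (⟨Lx, x⟩ ≥ 0), Δt > 0 and S > 0. Let φ⁰, φ¹, b, μ ∈ H and r⁰, r¹ ∈ ℝ satisfy: φ¹ − φ⁰ = Δt·Gμ; μ = Lφ¹ + r¹·b − 2S·φ⁰; r¹ − r⁰ = (1/2)⟨b, φ¹ − φ⁰⟩. Then [(1/2)⟨Lφ¹, φ¹⟩ + (r¹)² + S‖φ¹ − φ⁰‖² − S‖φ¹‖²] − [(1/2)⟨Lφ⁰, φ⁰⟩ + (r⁰)²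 − S‖φ⁰‖²] ≤ Δt·⟨Gμ, μ⟩ ≤ 0. -/
open scoped RealInnerProductSpace

/-- First-step (`n = 0`) energy stability of the MSAV scheme with linear `V(φ) = 2Sφ`. -/
theorem msav_first_step_energy_stable {H : Type*} [NormedAddCommGroup H] [InnerProductSpace ℝ H]
    (G L : H →L[ℝ] H)
    (hG : ∀ μ : H, ⟪G μ, μ⟫ ≤ 0)
    (hL : ∀ x y : H, ⟪L x, y⟫ = ⟪x, L y⟫)
    (hLpos : ∀ x : H, 0 ≤ ⟪L x, x⟫)
    (Δt S : ℝ) (hΔt : 0 < Δt) (hS : 0 < S)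
    (φ0 φ1 b μ : H) (r0 r1 : ℝ)
    (heq1 : φ1 - φ0 = Δt • G μ)
    (heq2 : μ = L φ1 + r1 • b - (2 * S) • φ0)
    (heq3 : r1 - r0 = (1 / 2 : ℝ) * ⟪b, φ1 - φ0⟫) :
    ((1 / 2 : ℝ) * ⟪L φ1, φ1⟫ + r1 ^ 2 + S * ‖φ1 - φ0‖ ^ 2 - S * ‖φ1‖ ^ 2)
      - ((1 / 2 : ℝ) * ⟪L φ0, φ0⟫ + r0 ^ 2 - S * ‖φ0‖ ^ 2)
      ≤ Δt * ⟪G μ, μ⟫ ∧ Δt * ⟪G μ, μ⟫ ≤ 0 := by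
  refine ⟨?_, mul_nonpos_of_nonneg_of_nonpos hΔt.le (hG μ)⟩
  have h1 : Δt * ⟪G μ, μ⟫ = ⟪φ1 - φ0, μ⟫ := by
    rw [heq1, real_inner_smul_left]
  have h2 : ⟪φ1 - φ0, μ⟫
      = ⟪φ1 - φ0, L φ1⟫ + r1 * ⟪b, φ1 - φ0⟫ - 2 * S * ⟪φ1 - φ0, φ0⟫ := by
    conv_lhs => rw [heq2]
    rw [inner_sub_right, inner_add_right, real_inner_smul_right, real_inner_smul_right,
      real_inner_comm b]
  have h3 := hLpos (φ1 - φ0)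
  have h4 : ‖φ1‖ ^ 2 = ‖φ1 - φ0‖ ^ 2 + 2 * ⟪φ1 - φ0, φ0⟫ + ‖φ0‖ ^ 2 := by
    have := norm_add_sq_real (φ1 - φ0) φ0
    rwa [sub_add_cancel] at this
  have h5 : ⟪b, φ1 - φ0⟫ = 2 * (r1 - r0) := by linarith
  have h6 : ⟪φ1 - φ0, L φ1⟫ = ⟪L φ1, φ1⟫ - ⟪L φ0, φ1⟫ := by
    rw [inner_sub_left, ← hL, ← hL]
  have h7 : ⟪L φ1, φ0⟫ = ⟪L φ0, φ1⟫ := by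
    rw [hL, real_inner_comm]
  rw [map_sub, inner_sub_left, inner_sub_right, inner_sub_right, h7] at h3
  rw [h1, h2, h5, h6, h4]
  nlinarith [sq_nonneg (r1 - r0)]
end

section
/- Let H be a real inner product space, G : H → H a continuous linear operator with ⟨Gμ, μ⟩ ≤ 0 for all μ ∈ H, L : H → H a continuous linear operator that is symmetric (⟨Lx, y⟩ = ⟨x, Ly⟩), Δt > 0 and S > 0. Let Bₙ : H → H be a self-adjoint continuous linear operator, and let φⁿ, φⁿ⁺¹, qⁿ, qⁿ⁺¹, μ ∈ H satisfy: φⁿ⁺¹ − φⁿ = Δt·Gμ; μ = L((φⁿ⁺¹ + φⁿ)/2) + S(φⁿ⁺¹ − φⁿ) + Bₙ((qⁿ⁺¹ + qⁿ)/2); qⁿ⁺¹ − qⁿ = (1/2)Bₙ(φⁿ⁺¹ − φⁿ). Define Eᵐ = (1/2)⟨Lφᵐ, φᵐ⟩ + ‖qᵐ‖² for m = n, n+1. Then Eⁿ⁺¹ − Eⁿ ≤ Δt·⟨Gμ, μ⟩ ≤ 0. -/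
open scoped RealInnerProductSpace

/-- Unconditional energy stability of the stabilized IEQ Crank–Nicolson scheme. -/
theorem stabilized_ieq_cn_energy_stable {H : Type*} [NormedAddCommGroup H]
    [InnerProductSpace ℝ H]
    (G L : H →L[ℝ] H)
    (hG : ∀ μ : H, ⟪G μ, μ⟫ ≤ 0)
    (hL : ∀ x y : H, ⟪L x, y⟫ = ⟪x, L y⟫)
    (Δt S : ℝ) (hΔt : 0 < Δt) (hS : 0 < S)
    (B : H →L[ℝ] H)
    (hB : ∀ x y : H, ⟪B x, y⟫ = ⟪x, B y⟫)
    (φn φn1 qn qn1 μ : H)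
    (heq1 : φn1 - φn = Δt • G μ)
    (heq2 : μ = L ((1 / 2 : ℝ) • (φn1 + φn)) + S • (φn1 - φn)
      + B ((1 / 2 : ℝ) • (qn1 + qn)))
    (heq3 : qn1 - qn = (1 / 2 : ℝ) • B (φn1 - φn)) :
    ((1 / 2 : ℝ) * ⟪L φn1, φn1⟫ + ‖qn1‖ ^ 2) - ((1 / 2 : ℝ) * ⟪L φn, φn⟫ + ‖qn‖ ^ 2)
      ≤ Δt * ⟪G μ, μ⟫ ∧ Δt * ⟪G μ, μ⟫ ≤ 0 := by
  refine ⟨?_, mul_nonpos_of_nonneg_of_nonpos hΔt.le (hG μ)⟩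
  have h1 : Δt * ⟪G μ, μ⟫ = ⟪φn1 - φn, μ⟫ := by
    rw [heq1, real_inner_smul_left]
  have h2 : ⟪φn1 - φn, μ⟫ = ⟪φn1 - φn, L ((1 / 2 : ℝ) • (φn1 + φn))⟫
      + S * ‖φn1 - φn‖ ^ 2 + ⟪φn1 - φn, B ((1 / 2 : ℝ) • (qn1 + qn))⟫ := by
    conv_lhs => rw [heq2]
    rw [inner_add_right, inner_add_right, real_inner_smul_right, real_inner_self_eq_norm_sq]
  have h3 : ⟪φn1 - φn, L ((1 / 2 : ℝ) • (φn1 + φn))⟫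
      = (1 / 2 : ℝ) * ⟪L φn1, φn1⟫ - (1 / 2 : ℝ) * ⟪L φn, φn⟫ := by
    have hc : ⟪φn1, L φn⟫ = ⟪φn, L φn1⟫ := by
      rw [← hL, real_inner_comm]
    rw [hL φn1, hL φn, map_smul, map_add, real_inner_smul_right, inner_add_right,
      inner_sub_left, inner_sub_left, hc]
    ring
  have h4 : ⟪φn1 - φn, B ((1 / 2 : ℝ) • (qn1 + qn))⟫ = ‖qn1‖ ^ 2 - ‖qn‖ ^ 2 := by
    have hb : B (φn1 - φn) = (2 : ℝ) • (qn1 - qn) := by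
      rw [heq3, smul_smul]; norm_num
    rw [← hB, hb, real_inner_smul_left, real_inner_smul_right, inner_sub_left,
      inner_add_right, inner_add_right, real_inner_self_eq_norm_sq,
      real_inner_self_eq_norm_sq, real_inner_comm qn1 qn]
    ring
  have h5 : 0 ≤ S * ‖φn1 - φn‖ ^ 2 := by positivity
  rw [h1, h2, h3, h4]
  linarith
end

section
/- Let H be a real inner product space, G : H → H a continuous linear operator, L : H → H a continuous linear operator that is symmetric (⟨Lx, y⟩ = ⟨x, Ly⟩), and Δt > 0. Let φⁿ⁻¹, φⁿ, φⁿ⁺¹, b, c, μ ∈ H and rⁿ⁻¹, rⁿ, rⁿ⁺¹, mⁿ⁻¹, mⁿ, mⁿ⁺¹ ∈ ℝ satisfy: 3φⁿ⁺¹ − 4φⁿ + φⁿ⁻¹ = 2Δt·Gμ; μ = Lφⁿ⁺¹ + rⁿ⁺¹·b − mⁿ⁺¹·c; 3rⁿ⁺¹ − 4rⁿ + rⁿ⁻¹ = (1/2)⟨b, 3φⁿ⁺¹ − 4φⁿ + φⁿ⁻¹⟩; 3mⁿ⁺¹ − 4mⁿ + mⁿ⁻¹ = (1/2)⟨c, 3φⁿ⁺¹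 − 4φⁿ + φⁿ⁻¹⟩. Define E(x, y, ρ, σ, α, β) = (1/2)[⟨Lx, x⟩ + ⟨L(2x − y), 2x − y⟩] + ρ² + (2ρ − σ)² − α² − (2α − β)². Then E(φⁿ⁺¹, φⁿ, rⁿ⁺¹, rⁿ, mⁿ⁺¹, mⁿ) − E(φⁿ, φⁿ⁻¹, rⁿ, rⁿ⁻¹, mⁿ, mⁿ⁻¹) = 2Δt·⟨Gμ, μ⟩ − (1/2)⟨L(φⁿ⁺¹ − 2φⁿ + φⁿ⁻¹), φⁿ⁺¹ − 2φⁿ + φⁿ⁻¹⟩ − (rⁿ⁺¹ − 2rⁿ + rⁿ⁻¹)² + (mⁿ⁺¹ − 2mⁿ + mⁿ⁻¹)². -/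
open scoped RealInnerProductSpace

/-- Discrete energy identity underlying the MSAV BDF2 scheme with two scalar
auxiliary variables. -/
theorem msav_bdf2_energy_identity {H : Type*} [NormedAddCommGroup H] [InnerProductSpace ℝ H]
    (G L : H →L[ℝ] H)
    (hL : ∀ x y : H, ⟪L x, y⟫ = ⟪x, L y⟫)
    (Δt : ℝ) (hΔt : 0 < Δt)
    (φnm1 φn φn1 b c μ : H) (rnm1 rn rn1 mnm1 mn mn1 : ℝ)
    (heq1 : (3 : ℝ) • φn1 - (4 : ℝ) • φn + φnm1 = (2 * Δt) • G μ)
    (heq2 : μ = L φn1 + rn1 • b - mn1 • c)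
    (heq3 : 3 * rn1 - 4 * rn + rnm1 = (1 / 2 : ℝ) * ⟪b, (3 : ℝ) • φn1 - (4 : ℝ) • φn + φnm1⟫)
    (heq4 : 3 * mn1 - 4 * mn + mnm1 = (1 / 2 : ℝ) * ⟪c, (3 : ℝ) • φn1 - (4 : ℝ) • φn + φnm1⟫)
    (E : H → H → ℝ → ℝ → ℝ → ℝ → ℝ)
    (hE : ∀ (x y : H) (ρ σ α β : ℝ), E x y ρ σ α β =
      (1 / 2 : ℝ) * (⟪L x, x⟫ + ⟪L ((2 : ℝ) • x - y), (2 : ℝ) • x - y⟫)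
        + ρ ^ 2 + (2 * ρ - σ) ^ 2 - α ^ 2 - (2 * α - β) ^ 2) :
    E φn1 φn rn1 rn mn1 mn - E φn φnm1 rn rnm1 mn mnm1 =
      2 * Δt * ⟪G μ, μ⟫
        - (1 / 2 : ℝ) * ⟪L (φn1 - (2 : ℝ) • φn + φnm1), φn1 - (2 : ℝ) • φn + φnm1⟫
        - (rn1 - 2 * rn + rnm1) ^ 2 + (mn1 - 2 * mn + mnm1) ^ 2 := by
  have key : 2 * Δt * ⟪G μ, μ⟫ = ⟪L φn1, (3 : ℝ) • φn1 - (4 : ℝ) • φn + φnm1⟫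
      + rn1 * (2 * (3 * rn1 - 4 * rn + rnm1)) - mn1 * (2 * (3 * mn1 - 4 * mn + mnm1)) := by
    have h1 : 2 * Δt * ⟪G μ, μ⟫ = ⟪μ, (3 : ℝ) • φn1 - (4 : ℝ) • φn + φnm1⟫ := by
      rw [heq1, real_inner_smul_right, real_inner_comm]
    rw [h1, heq3, heq4]
    generalize (3 : ℝ) • φn1 - (4 : ℝ) • φn + φnm1 = D
    rw [heq2, inner_sub_left, inner_add_left, real_inner_smul_left, real_inner_smul_left]
    ring
  have s1 : ⟪L φn, φn1⟫ = ⟪L φn1, φn⟫ := by rw [hL, real_inner_comm]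
  have s2 : ⟪L φnm1, φn1⟫ = ⟪L φn1, φnm1⟫ := by rw [hL, real_inner_comm]
  have s3 : ⟪L φnm1, φn⟫ = ⟪L φn, φnm1⟫ := by rw [hL, real_inner_comm]
  rw [key, hE, hE]
  simp only [map_add, map_sub, map_smul, inner_add_left, inner_add_right, inner_sub_left,
    inner_sub_right, real_inner_smul_left, real_inner_smul_right, s1, s2, s3]
  ring
end
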